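/- arXiv:2512.03831 — 2 statements merged into one kernel-verified Lean document; each statement's English description precedes it below -/
import Mathlib

section
/- Let D ⊆ ℝ² be open, c, g ∈ ℝ, and u, v, P, ρ : D → ℝ continuously differentiable with ρ > 0, satisfying the momentum equations (u−c)u_x + v u_y + P_x/ρ = 0 and (u−c)v_x + v v_y + P_y/ρ = −g on D. Let ψ : D → ℝ be twice continuously differentiable with ψ_x = −√ρ·v and ψ_y = √ρ·(u−c) on D, and suppose ρ(x,y) = r(−ψ(x,y)) on D for a continuously differentiable function r : ℝ → ℝ. Then the function E := ½(ψ_x² + ψ_y²) + P + gρy satisfies ∇E = (Δψ − g y r'(−ψ)) ∇ψ at every point of D. In particular, if in addition E(x,y) = Ẽ(ψ(x,y)) on D for a differentiable function Ẽ with derivative β, then at every point of D where ∇ψ ≠ 0 one has Δψ = g y r'(−ψ) + β(ψ). -/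
/-- partial derivative in `x` of a real-valued function on `ℝ²`. -/
noncomputable def pdx (f : ℝ × ℝ → ℝ) (p : ℝ × ℝ) : ℝ :=
  deriv (fun t => f (t, p.2)) p.1

/-- partial derivative in `y` of a real-valued function on `ℝ²`. -/
noncomputable def pdy (f : ℝ × ℝ → ℝ) (p : ℝ × ℝ) : ℝ :=
  deriv (fun t => f (p.1, t)) p.2

/-- Laplacian of a real-valued function on `ℝ²` (via iterated coordinate derivatives). -/
noncomputable def lap (f : ℝ × ℝ → ℝ) (p : ℝ × ℝ) : ℝ :=
  pdx (pdx f) p + pdy (pdy f) p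

theorem HasFDerivAt.pdx_eq {f : ℝ × ℝ → ℝ} {L : ℝ × ℝ →L[ℝ] ℝ} {p : ℝ × ℝ}
    (h : HasFDerivAt f L p) : pdx f p = L (1, 0) :=
  (h.comp_hasDerivAt (f := fun t => (t, p.2)) p.1
    ((hasDerivAt_id p.1).prodMk (hasDerivAt_const p.1 p.2))).deriv

theorem HasFDerivAt.pdy_eq {f : ℝ × ℝ → ℝ} {L : ℝ × ℝ →L[ℝ] ℝ} {p : ℝ × ℝ}
    (h : HasFDerivAt f L p) : pdy f p = L (0, 1) :=
  (h.comp_hasDerivAt (f := fun t => (p.1, t)) p.2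
    ((hasDerivAt_const p.2 p.1).prodMk (hasDerivAt_id p.2))).deriv

/-- with `ρ = r(−ψ)`, the Bernoulli quantity
`E = ½|∇ψ|² + P + gρy` satisfies `∇E = (Δψ − g y r'(−ψ))∇ψ`; in particular,
if `E = Ẽ(ψ)` with `Ẽ' = β`, then `Δψ = g y r'(−ψ) + β(ψ)` wherever `∇ψ ≠ 0`. -/
theorem stmt_3 (D : Set (ℝ × ℝ)) (hD : IsOpen D) (c g : ℝ)
    (u v P ρ : ℝ × ℝ → ℝ)
    (hu : ContDiffOn ℝ 1 u D) (hv : ContDiffOn ℝ 1 v D)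
    (hP : ContDiffOn ℝ 1 P D) (hρ : ContDiffOn ℝ 1 ρ D)
    (hρpos : ∀ p ∈ D, 0 < ρ p)
    (hmom1 : ∀ p ∈ D, (u p - c) * pdx u p + v p * pdy u p + pdx P p / ρ p = 0)
    (hmom2 : ∀ p ∈ D, (u p - c) * pdx v p + v p * pdy v p + pdy P p / ρ p = -g)
    (ψ : ℝ × ℝ → ℝ) (hψ : ContDiffOn ℝ 2 ψ D)
    (hψx : ∀ p ∈ D, pdx ψ p = -Real.sqrt (ρ p) * v p)
    (hψy : ∀ p ∈ D, pdy ψ p = Real.sqrt (ρ p) * (u p - c))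
    (r : ℝ → ℝ) (hr : ContDiff ℝ 1 r)
    (hρr : ∀ p ∈ D, ρ p = r (-(ψ p)))
    (E : ℝ × ℝ → ℝ)
    (hE : E = fun p => (1 / 2) * ((pdx ψ p) ^ 2 + (pdy ψ p) ^ 2) + P p + g * ρ p * p.2) :
    (∀ p ∈ D,
      pdx E p = (lap ψ p - g * p.2 * deriv r (-(ψ p))) * pdx ψ p ∧
      pdy E p = (lap ψ p - g * p.2 * deriv r (-(ψ p))) * pdy ψ p) ∧
    (∀ Etil β : ℝ → ℝ, (∀ s : ℝ, HasDerivAt Etil (β s) s) →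
      (∀ p ∈ D, E p = Etil (ψ p)) →
      ∀ p ∈ D, (pdx ψ p, pdy ψ p) ≠ (0, 0) →
        lap ψ p = g * p.2 * deriv r (-(ψ p)) + β (ψ p)) := by
  have grad : ∀ p ∈ D,
      pdx E p = (lap ψ p - g * p.2 * deriv r (-(ψ p))) * pdx ψ p ∧
      pdy E p = (lap ψ p - g * p.2 * deriv r (-(ψ p))) * pdy ψ p := by
    intro p hp
    have hn : D ∈ nhds p := hD.mem_nhds hp
    have du := ((hu.contDiffAt hn).differentiableAt one_ne_zero).hasFDerivAt
    have dv := ((hv.contDiffAt hn).differentiableAt one_ne_zero).hasFDerivAt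
    have dP := ((hP.contDiffAt hn).differentiableAt one_ne_zero).hasFDerivAt
    have dρ := ((hρ.contDiffAt hn).differentiableAt one_ne_zero).hasFDerivAt
    have dψ := ((hψ.contDiffAt hn).differentiableAt two_ne_zero).hasFDerivAt
    have dr := (hr.differentiable one_ne_zero (-(ψ p))).hasDerivAt
    have ds := dρ.sqrt (hρpos p hp).ne'
    have dρ' : HasFDerivAt ρ (deriv r (-(ψ p)) • -fderiv ℝ ψ p) p :=
      (dr.comp_hasFDerivAt p dψ.neg).congr_of_eventuallyEq
        (Filter.eventually_of_mem hn hρr)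
    have eρ := dρ.unique dρ'
    have da := (ds.neg.mul dv).congr_of_eventuallyEq (Filter.eventually_of_mem hn hψx)
    have db := (ds.mul (du.sub_const c)).congr_of_eventuallyEq
      (Filter.eventually_of_mem hn hψy)
    have dE := ((((da.pow 2).add (db.pow 2)).const_mul (1 / 2)).add dP).add
      ((dρ.const_mul g).mul (hasFDerivAt_snd (p := p)))
    have dE' : HasFDerivAt E _ p := dE.congr_of_eventuallyEq (.of_eq hE)
    have m1 := hmom1 p hp
    have m2 := hmom2 p hp
    have hx := hψx p hp
    have hy := hψy p hp
    have hs : 0 < √(ρ p) := Real.sqrt_pos.2 (hρpos p hp)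
    have hs2 : ρ p = √(ρ p) ^ 2 := (Real.sq_sqrt (hρpos p hp).le).symm
    have ρx := congrArg (fun L => L (1, 0)) eρ
    have ρy := congrArg (fun L => L (0, 1)) eρ
    rw [du.pdx_eq, du.pdy_eq, dP.pdx_eq] at m1
    rw [dv.pdx_eq, dv.pdy_eq, dP.pdy_eq] at m2
    simp only [lap, dE'.pdx_eq, dE'.pdy_eq, da.pdx_eq, db.pdy_eq]
    simp only [smul_eq_mul, smul_apply, neg_apply,
      add_apply, ContinuousLinearMap.coe_snd', ← dψ.pdx_eq,
      ← dψ.pdy_eq, hx, hy] at ρx ρy ⊢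
    simp only [Pi.neg_apply]
    rw [ρx, ρy]
    have hρ0 : ρ p ≠ 0 := (hρpos p hp).ne'
    have px : fderiv ℝ P p (1, 0) =
        -ρ p * ((u p - c) * fderiv ℝ u p (1, 0) + v p * fderiv ℝ u p (0, 1)) := by
      field_simp at m1
      linear_combination m1
    have py : fderiv ℝ P p (0, 1) =
        -ρ p * (g + (u p - c) * fderiv ℝ v p (1, 0) + v p * fderiv ℝ v p (0, 1)) := by
      field_simp at m2
      linear_combination m2
    rw [px, py]
    generalize √(ρ p) = s at hs hs2 ⊢
    rw [hs2]
    constructor <;> field_simp <;> ring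
  refine ⟨grad, ?_⟩
  intro Etil β hβ hEψ p hp hne
  have hn : D ∈ nhds p := hD.mem_nhds hp
  have dψ := ((hψ.contDiffAt hn).differentiableAt two_ne_zero).hasFDerivAt
  have dE : HasFDerivAt E (β (ψ p) • fderiv ℝ ψ p) p :=
    ((hβ (ψ p)).comp_hasFDerivAt p dψ).congr_of_eventuallyEq
      (Filter.eventually_of_mem hn hEψ)
  obtain ⟨gx, gy⟩ := grad p hp
  rw [dE.pdx_eq, smul_apply, ← dψ.pdx_eq, smul_eq_mul] at gx
  rw [dE.pdy_eq, smul_apply, ← dψ.pdy_eq, smul_eq_mul] at gy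
  by_cases h : pdx ψ p = 0
  · have h' : pdy ψ p ≠ 0 := fun h' => hne (by rw [h, h'])
    linarith [mul_right_cancel₀ h' gy]
  · linarith [mul_right_cancel₀ h gx]
end

section
/- Let g, ρ₀, R, d ∈ ℝ, let ξ : ℝ → ℝ be continuously differentiable, and let ψ be twice continuously differentiable on an open neighborhood of the graph S = {(x, ξ(x)) : x ∈ ℝ}. Assume that for all x: ψ(x, ξ(x)) = 0, ½(ψ_x(x,ξ(x))² + ψ_y(x,ξ(x))²) + gρ₀(ξ(x) + d) = R, and ψ_y(x, ξ(x)) ≠ 0. Then for every x: ξ'(x) = −ψ_x(x,ξ(x))/ψ_y(x,ξ(x)), and the function w := ∂ₓψ satisfies the linearized boundary condition ψ_x w_x + ψ_y w_y − σ(x) w = 0 at the point (x, ξ(x)), where σ(x) = (ψ_x ψ_{xy} + ψ_y ψ_{yy} + gρ₀)/ψ_y evaluated at (x, ξ(x)). -/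
open Filter Topology

theorem pdx_eq_fderiv {f : ℝ × ℝ → ℝ} {p : ℝ × ℝ} (hf : DifferentiableAt ℝ f p) :
    pdx f p = fderiv ℝ f p (1, 0) :=
  (hf.hasFDerivAt.comp_hasDerivAt p.1
    ((hasDerivAt_id p.1).prodMk (hasDerivAt_const p.1 p.2))).deriv

theorem pdy_eq_fderiv {f : ℝ × ℝ → ℝ} {p : ℝ × ℝ} (hf : DifferentiableAt ℝ f p) :
    pdy f p = fderiv ℝ f p (0, 1) :=
  (hf.hasFDerivAt.comp_hasDerivAt p.2
    ((hasDerivAt_const p.2 p.1).prodMk (hasDerivAt_id p.2))).deriv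

/-- Chain rule along the graph of `ξ`. -/
theorem hasDerivAt_comp_graph {f : ℝ × ℝ → ℝ} {ξ : ℝ → ℝ} {x ξ' : ℝ}
    (hf : DifferentiableAt ℝ f (x, ξ x)) (hξ : HasDerivAt ξ ξ' x) :
    HasDerivAt (fun t => f (t, ξ t)) (pdx f (x, ξ x) + pdy f (x, ξ x) * ξ') x := by
  have h := hf.hasFDerivAt.comp_hasDerivAt x ((hasDerivAt_id x).prodMk hξ)
  have hv : ((1, ξ') : ℝ × ℝ) = (1, 0) + ξ' • (0, 1) := by simp
  rw [hv, map_add, map_smul, ← pdx_eq_fderiv hf, ← pdy_eq_fderiv hf, smul_eq_mul,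
    mul_comm] at h
  exact h

theorem eventually_differentiableAt {f : ℝ × ℝ → ℝ} {p : ℝ × ℝ} (hf : ContDiffAt ℝ 2 f p) :
    ∀ᶠ q in 𝓝 p, DifferentiableAt ℝ f q :=
  (hf.eventually (by simp)).mono fun _ hq => hq.differentiableAt (by simp)

theorem hasFDerivAt_fderiv_apply {f : ℝ × ℝ → ℝ} {p : ℝ × ℝ} (hf : ContDiffAt ℝ 2 f p)
    (v : ℝ × ℝ) :
    HasFDerivAt (fun q => fderiv ℝ f q v) ((fderiv ℝ (fderiv ℝ f) p).flip v) p := by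
  have h : DifferentiableAt ℝ (fderiv ℝ f) p :=
    (hf.fderiv_right (m := 1) (by norm_num)).differentiableAt (by simp)
  simpa using h.hasFDerivAt.clm_apply (hasFDerivAt_const v p)

theorem hasFDerivAt_pdx {f : ℝ × ℝ → ℝ} {p : ℝ × ℝ} (hf : ContDiffAt ℝ 2 f p) :
    HasFDerivAt (pdx f) ((fderiv ℝ (fderiv ℝ f) p).flip (1, 0)) p :=
  (hasFDerivAt_fderiv_apply hf _).congr_of_eventuallyEq
    ((eventually_differentiableAt hf).mono fun _ hq => pdx_eq_fderiv hq)

theorem hasFDerivAt_pdy {f : ℝ × ℝ → ℝ} {p : ℝ × ℝ} (hf : ContDiffAt ℝ 2 f p) :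
    HasFDerivAt (pdy f) ((fderiv ℝ (fderiv ℝ f) p).flip (0, 1)) p :=
  (hasFDerivAt_fderiv_apply hf _).congr_of_eventuallyEq
    ((eventually_differentiableAt hf).mono fun _ hq => pdy_eq_fderiv hq)

/-- Symmetry of the mixed second partial derivatives. -/
theorem pdx_pdy_eq_pdy_pdx {f : ℝ × ℝ → ℝ} {p : ℝ × ℝ} (hf : ContDiffAt ℝ 2 f p) :
    pdx (pdy f) p = pdy (pdx f) p := by
  have hx := hasFDerivAt_pdx hf
  have hy := hasFDerivAt_pdy hf
  rw [pdx_eq_fderiv hy.differentiableAt, pdy_eq_fderiv hx.differentiableAt, hx.fderiv, hy.fderiv]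
  exact (hf.isSymmSndFDerivAt (by simp)).eq (1, 0) (0, 1)

/-- on the free surface `y = ξ(x)`, the kinematic and
Bernoulli conditions imply `ξ' = −ψ_x/ψ_y`, and `w = ∂ₓψ` satisfies the
linearized boundary condition `ψ_x w_x + ψ_y w_y − σ w = 0` with
`σ = (ψ_x ψ_{xy} + ψ_y ψ_{yy} + gρ₀)/ψ_y`. -/
theorem stmt_7 (g ρ₀ R d : ℝ) (ξ : ℝ → ℝ) (hξ : ContDiff ℝ 1 ξ)
    (U : Set (ℝ × ℝ)) (hU : IsOpen U) (hSU : ∀ x : ℝ, (x, ξ x) ∈ U)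
    (ψ : ℝ × ℝ → ℝ) (hψ : ContDiffOn ℝ 2 ψ U)
    (h0 : ∀ x : ℝ, ψ (x, ξ x) = 0)
    (hbern : ∀ x : ℝ,
      (1 / 2) * ((pdx ψ (x, ξ x)) ^ 2 + (pdy ψ (x, ξ x)) ^ 2) + g * ρ₀ * (ξ x + d) = R)
    (hψy : ∀ x : ℝ, pdy ψ (x, ξ x) ≠ 0) :
    ∀ x : ℝ,
      deriv ξ x = -(pdx ψ (x, ξ x)) / pdy ψ (x, ξ x) ∧
      pdx ψ (x, ξ x) * pdx (pdx ψ) (x, ξ x) + pdy ψ (x, ξ x) * pdy (pdx ψ) (x, ξ x) -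
        ((pdx ψ (x, ξ x) * pdy (pdx ψ) (x, ξ x) +
          pdy ψ (x, ξ x) * pdy (pdy ψ) (x, ξ x) + g * ρ₀) / pdy ψ (x, ξ x)) *
          pdx ψ (x, ξ x) = 0 := by
  intro x
  have hf : ContDiffAt ℝ 2 ψ (x, ξ x) := hψ.contDiffAt (hU.mem_nhds (hSU x))
  have hξx : HasDerivAt ξ (deriv ξ x) x := (hξ.differentiable (by simp) x).hasDerivAt
  have hy := hψy x
  have hkin : pdx ψ (x, ξ x) + pdy ψ (x, ξ x) * deriv ξ x = 0 := by
    have h := hasDerivAt_comp_graph (hf.differentiableAt (by simp)) hξx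
    simp only [h0] at h
    exact h.unique (hasDerivAt_const x 0)
  have hslope : deriv ξ x = -(pdx ψ (x, ξ x)) / pdy ψ (x, ξ x) := by
    rw [eq_div_iff hy]
    linarith
  have hdyn : pdx ψ (x, ξ x) *
        (pdx (pdx ψ) (x, ξ x) + pdy (pdx ψ) (x, ξ x) * deriv ξ x) +
      pdy ψ (x, ξ x) * (pdy (pdx ψ) (x, ξ x) + pdy (pdy ψ) (x, ξ x) * deriv ξ x) +
      g * ρ₀ * deriv ξ x = 0 := by
    have hu := hasDerivAt_comp_graph (hasFDerivAt_pdx hf).differentiableAt hξx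
    have hv := hasDerivAt_comp_graph (hasFDerivAt_pdy hf).differentiableAt hξx
    rw [pdx_pdy_eq_pdy_pdx hf] at hv
    have h := (((hu.fun_pow 2).fun_add (hv.fun_pow 2)).const_mul (1 / 2)).fun_add
      ((hξx.add_const d).const_mul (g * ρ₀))
    simp only [hbern] at h
    have h' := h.unique (hasDerivAt_const x R)
    norm_num at h'
    linear_combination h'
  refine ⟨hslope, ?_⟩
  rw [hslope] at hdyn
  linear_combination hdyn
end
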